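/- arXiv:2510.04151 — 8 statements merged into one kernel-verified Lean document; each statement's English description precedes it below -/
import Mathlib

section
/- The potential F satisfies the WDVV associativity equations: for all (z¹,z²,z³) with z¹ > 0 and all indices α,β,γ,δ ∈ {1,2,3}, Σ_{μ,ν} (∂³F/∂z^α∂z^β∂z^μ) η^{μν} (∂³F/∂z^ν∂z^γ∂z^δ) = Σ_{μ,ν} (∂³F/∂z^δ∂z^β∂z^μ) η^{μν} (∂³F/∂z^ν∂z^γ∂z^α). -/
/-- Partial derivative in the first slot. -/
noncomputable def pd1 (f : ℝ → ℝ → ℝ → ℝ) : ℝ → ℝ → ℝ → ℝ :=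
  fun x y z => deriv (fun t => f t y z) x

/-- Partial derivative in the second slot. -/
noncomputable def pd2 (f : ℝ → ℝ → ℝ → ℝ) : ℝ → ℝ → ℝ → ℝ :=
  fun x y z => deriv (fun t => f x t z) y

/-- Partial derivative in the third slot. -/
noncomputable def pd3 (f : ℝ → ℝ → ℝ → ℝ) : ℝ → ℝ → ℝ → ℝ :=
  fun x y z => deriv (fun t => f x y t) z

/-- Partial derivative in the (i+1)-st variable. -/
noncomputable def pd (i : Fin 3) : (ℝ → ℝ → ℝ → ℝ) → (ℝ → ℝ → ℝ → ℝ) :=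
  ![pd1, pd2, pd3] i

/-- The potential of the generalized Frobenius manifold of the (2,1)-type RR2T. -/
noncomputable def Fpot (x y z : ℝ) : ℝ :=
  (1/2) * x^2 * z + (1/2) * x * y^2 + Real.sqrt 2 * x * y * Real.exp z
    + (1/2) * x * Real.exp (2*z) - (1/24) * y^4 + (1/2) * x^2 * Real.log x

/-- The flat metric η, with η_{αβ} = 1 iff α + β = 4 (indices shifted to 0,1,2). -/
noncomputable def eta (a b : Fin 3) : ℝ := if (a : ℕ) + (b : ℕ) = 2 then 1 else 0

/-- Third partial derivatives c_{αβγ} = ∂³F/∂z^α∂z^β∂z^γ of the potential. -/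
noncomputable def cF (a b g : Fin 3) : ℝ → ℝ → ℝ → ℝ := pd a (pd b (pd g Fpot))

/-- The gradient of the potential on `x > 0`. -/
noncomputable def potGrad : Fin 3 → ℝ → ℝ → ℝ → ℝ :=
  ![fun x y z => x * z + (1/2) * y^2 + √2 * y * Real.exp z + (1/2) * Real.exp (2*z)
      + x * Real.log x + (1/2) * x,
    fun x y z => x * y + √2 * x * Real.exp z - (1/6) * y^3,
    fun x y z => (1/2) * x^2 + √2 * x * y * Real.exp z + x * Real.exp (2*z)]

/-- The Hessian of the potential on `x > 0`. -/
noncomputable def potHess : Fin 3 → Fin 3 → ℝ → ℝ → ℝ → ℝ :=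
  ![![fun x _ z => z + Real.log x + 3/2,
      fun _ y z => y + √2 * Real.exp z,
      fun x y z => x + √2 * y * Real.exp z + Real.exp (2*z)],
    ![fun _ y z => y + √2 * Real.exp z,
      fun x y _ => x - (1/2) * y^2,
      fun x _ z => √2 * x * Real.exp z],
    ![fun x y z => x + √2 * y * Real.exp z + Real.exp (2*z),
      fun x _ z => √2 * x * Real.exp z,
      fun x y z => √2 * x * y * Real.exp z + 2 * x * Real.exp (2*z)]]

/-- The third derivatives of the potential on `x > 0`. -/
noncomputable def potThird (x y z : ℝ) : Fin 3 → Fin 3 → Fin 3 → ℝ :=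
  ![![![x⁻¹, 0, 1],
      ![0, 1, √2 * Real.exp z],
      ![1, √2 * Real.exp z, √2 * y * Real.exp z + 2 * Real.exp (2*z)]],
    ![![0, 1, √2 * Real.exp z],
      ![1, -y, 0],
      ![√2 * Real.exp z, 0, √2 * x * Real.exp z]],
    ![![1, √2 * Real.exp z, √2 * y * Real.exp z + 2 * Real.exp (2*z)],
      ![√2 * Real.exp z, 0, √2 * x * Real.exp z],
      ![√2 * y * Real.exp z + 2 * Real.exp (2*z), √2 * x * Real.exp z,
        √2 * x * y * Real.exp z + 4 * x * Real.exp (2*z)]]]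

theorem pd_congr_of_pos {f g : ℝ → ℝ → ℝ → ℝ} (h : ∀ x y z, 0 < x → f x y z = g x y z)
    (i : Fin 3) {x : ℝ} (hx : 0 < x) (y z : ℝ) : pd i f x y z = pd i g x y z := by
  fin_cases i
  · refine Filter.EventuallyEq.deriv_eq ?_
    filter_upwards [lt_mem_nhds hx] with t ht using h t y z ht
  · exact congrArg (deriv · y) (funext fun t => h x t z hx)
  · exact congrArg (deriv · z) (funext fun t => h x y t hx)

theorem hasDerivAt_exp_two_mul (z : ℝ) :
    HasDerivAt (fun t : ℝ => Real.exp (2 * t)) (2 * Real.exp (2 * z)) z := by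
  simpa [mul_comm] using ((hasDerivAt_id z).const_mul 2).exp

theorem pd_Fpot (i : Fin 3) {x : ℝ} (hx : 0 < x) (y z : ℝ) :
    pd i Fpot x y z = potGrad i x y z := by
  have hx' := hx.ne'
  fin_cases i <;>
  simp (disch := first | assumption | fun_prop (disch := assumption))
    [pd, pd1, pd2, pd3, Fpot, potGrad, deriv_fun_add, deriv_fun_sub, deriv_fun_mul,
      deriv_fun_pow, (hasDerivAt_exp_two_mul _).deriv] <;> field_simp <;> ring

theorem pd_potGrad (i j : Fin 3) {x : ℝ} (hx : 0 < x) (y z : ℝ) :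
    pd i (potGrad j) x y z = potHess i j x y z := by
  have hx' := hx.ne'
  fin_cases i <;> fin_cases j <;>
  simp (disch := first | assumption | fun_prop (disch := assumption))
    [pd, pd1, pd2, pd3, potHess, potGrad, deriv_fun_add, deriv_fun_sub, deriv_fun_mul,
      deriv_fun_pow, (hasDerivAt_exp_two_mul _).deriv] <;> field_simp <;> ring

theorem pd_potHess (i j k : Fin 3) {x : ℝ} (hx : 0 < x) (y z : ℝ) :
    pd i (potHess j k) x y z = potThird x y z i j k := by
  have hx' := hx.ne'
  fin_cases i <;> fin_cases j <;> fin_cases k <;>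
  simp (disch := first | assumption | fun_prop (disch := assumption))
    [pd, pd1, pd2, pd3, potHess, potThird, deriv_fun_add, deriv_fun_sub, deriv_fun_mul,
      deriv_fun_pow, (hasDerivAt_exp_two_mul _).deriv] <;> ring

theorem cF_eq_potThird (i j k : Fin 3) {x : ℝ} (hx : 0 < x) (y z : ℝ) :
    cF i j k x y z = potThird x y z i j k := by
  rw [← pd_potHess i j k hx]
  refine pd_congr_of_pos (fun x y z hx => ?_) i hx y z
  rw [← pd_potGrad j k hx]
  exact pd_congr_of_pos (fun x y z hx => pd_Fpot k hx y z) j hx y z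

/-- the potential F satisfies the WDVV associativity equations. -/
theorem wdvv_for_F (x y z : ℝ) (hx : 0 < x) (α β γ δ : Fin 3) :
    ∑ μ : Fin 3, ∑ ν : Fin 3, cF α β μ x y z * eta μ ν * cF ν γ δ x y z =
    ∑ μ : Fin 3, ∑ ν : Fin 3, cF δ β μ x y z * eta μ ν * cF ν γ α x y z := by
  have hs : √(2 : ℝ) ^ 2 = 2 := Real.sq_sqrt (by norm_num)
  have he : Real.exp (2 * z) = Real.exp z ^ 2 := by rw [two_mul, Real.exp_add, sq]
  have hxi : x⁻¹ * x = 1 := inv_mul_cancel₀ hx.ne'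
  simp only [cF_eq_potThird _ _ _ hx]
  fin_cases α <;> fin_cases δ <;> fin_cases β <;> fin_cases γ <;>
    simp [Fin.sum_univ_three, eta, potThird, he] <;> grind
end

section
/- The potential F satisfies the quasi-homogeneity condition E F = 2F + (3/4)(z¹)² on the domain z¹ > 0, where E is the vector field E = z¹ ∂/∂z¹ + ½ z² ∂/∂z² + ½ ∂/∂z³; i.e. z¹ ∂F/∂z¹ + ½ z² ∂F/∂z² + ½ ∂F/∂z³ = 2F + (3/4)(z¹)². -/
theorem hasDerivAt_Fpot_fst (x y z : ℝ) (hx : x ≠ 0) :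
    HasDerivAt (fun t => Fpot t y z)
      (x * z + (1/2) * y^2 + Real.sqrt 2 * y * Real.exp z + (1/2) * Real.exp (2*z)
        + x * Real.log x + (1/2) * x) x := by
  have hid := hasDerivAt_id' x
  have hsq := (hid.pow 2).const_mul (1/2 : ℝ)
  have h := (((((hsq.mul_const z).add ((hid.const_mul (1/2 : ℝ)).mul_const (y^2))).add
    (((hid.const_mul (Real.sqrt 2)).mul_const y).mul_const (Real.exp z))).add
    ((hid.const_mul (1/2 : ℝ)).mul_const (Real.exp (2*z)))).sub_const ((1/24) * y^4)).add
    (hsq.mul (Real.hasDerivAt_log hx))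
  refine h.congr_deriv ?_
  simp only [Pi.pow_apply]
  field_simp
  ring

theorem hasDerivAt_Fpot_snd (x y z : ℝ) :
    HasDerivAt (fun t => Fpot x t z)
      (x * y + Real.sqrt 2 * x * Real.exp z - (1/6) * y^3) y := by
  have hid := hasDerivAt_id' y
  have h := (((((hasDerivAt_const y ((1/2) * x^2 * z)).add
    ((hid.pow 2).const_mul ((1/2) * x))).add
    ((hid.const_mul (Real.sqrt 2 * x)).mul_const (Real.exp z))).add_const
    ((1/2) * x * Real.exp (2*z))).sub ((hid.pow 4).const_mul (1/24 : ℝ))).add_const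
    ((1/2) * x^2 * Real.log x)
  refine h.congr_deriv ?_
  norm_num
  ring

theorem hasDerivAt_Fpot_thd (x y z : ℝ) :
    HasDerivAt (fun t => Fpot x y t)
      ((1/2) * x^2 + Real.sqrt 2 * x * y * Real.exp z + x * Real.exp (2*z)) z := by
  have hid := hasDerivAt_id' z
  have h := (((((hid.const_mul ((1/2) * x^2)).add_const ((1/2) * x * y^2)).add
    ((Real.hasDerivAt_exp z).const_mul (Real.sqrt 2 * x * y))).add
    ((hid.const_mul 2).exp.const_mul ((1/2) * x))).sub_const ((1/24) * y^4)).add_const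
    ((1/2) * x^2 * Real.log x)
  refine h.congr_deriv ?_
  ring

/-- quasi-homogeneity E F = 2 F + (3/4)(z¹)² for
E = z¹ ∂₁ + ½ z² ∂₂ + ½ ∂₃. -/
theorem quasi_homogeneity_F (x y z : ℝ) (hx : 0 < x) :
    x * pd1 Fpot x y z + (1/2) * y * pd2 Fpot x y z + (1/2) * pd3 Fpot x y z
      = 2 * Fpot x y z + (3/4) * x^2 := by
  simp only [pd1, pd2, pd3]
  rw [(hasDerivAt_Fpot_fst x y z hx.ne').deriv, (hasDerivAt_Fpot_snd x y z).deriv,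
    (hasDerivAt_Fpot_thd x y z).deriv, Fpot]
  ring
end

section
/- Let u, v, w : ℤ → ℝ with v(n) ≠ 0 and w(n) ≠ 0 for all n, let ρ : ℤ → ℝ be nowhere zero with ρ(n+1)/ρ(n) = −w(n+1)/v(n+1) for all n, let λ ∈ ℂ, and let ψ, φ : ℤ → ℂ with ψ(n) = ρ(n)φ(n) for all n. Suppose ψ satisfies the spectral problem of the (2,1)-type RR2T: ψ(n+2) + u(n)ψ(n+1) + v(n)ψ(n) = λ(ψ(n) − w(n)ψ(n−1)) for all n. Then φ satisfies, for all n: φ(n) + U(n)φ(n+1) + V(n)φ(n+2) = λ(φ(n−1) + W(n)φ(n)), where U = −u w⁺/(v v⁺), V = w⁺ w⁺⁺/(v v⁺ v⁺⁺), W = 1/v, with f⁺(n) = f(n+1), f⁺⁺(n) = f(n+2). That is, the gauge transformation ψ = ρφ turns the spectral problem of the RR2T of type (2,1) into the spectral problem of the RR2T of type (1,2) with spectral parameter 1/λ and spatial reflection Λ^{±} ↦ Λ^{∓}. -/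
/-- the gauge transformation ψ = ρφ turns the spectral problem of the RR2T
of type (2,1) into the spectral problem of the RR2T of type (1,2) with spectral parameter
1/λ and spatial reflection. -/
theorem gauge_transformation_21_to_12
    (u v w ρ : ℤ → ℝ) (ψ φ : ℤ → ℂ) (lam : ℂ)
    (hv : ∀ n, v n ≠ 0) (hw : ∀ n, w n ≠ 0) (hρ : ∀ n, ρ n ≠ 0)
    (hρrec : ∀ n, ρ (n+1) / ρ n = - w (n+1) / v (n+1))
    (hgauge : ∀ n, ψ n = (ρ n : ℂ) * φ n)
    (hspec : ∀ n, ψ (n+2) + (u n : ℂ) * ψ (n+1) + (v n : ℂ) * ψ n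
        = lam * (ψ n - (w n : ℂ) * ψ (n-1))) :
    ∀ n, φ n + ((-(u n * w (n+1)) / (v n * v (n+1)) : ℝ) : ℂ) * φ (n+1)
        + ((w (n+1) * w (n+2) / (v n * v (n+1) * v (n+2)) : ℝ) : ℂ) * φ (n+2)
      = lam * (φ (n-1) + ((1 / v n : ℝ) : ℂ) * φ n) := by
  intro n
  have w_cast : ∀ m, (w (m+1) : ℂ) = -(ρ (m+1) * v (m+1) / ρ m) := by
    intro m
    have h := hρrec m
    rw [div_eq_div_iff (hρ m) (hv (m+1))] at h
    rw [← neg_eq_iff_eq_neg, eq_div_iff (by exact_mod_cast hρ m)]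
    exact_mod_cast h.symm
  have hvc : ∀ m, (v m : ℂ) ≠ 0 := fun m => by exact_mod_cast hv m
  have hρc : ∀ m, (ρ m : ℂ) ≠ 0 := fun m => by exact_mod_cast hρ m
  have w_zero := w_cast (n-1)
  have w_one := w_cast n
  have w_two := w_cast (n+1)
  rw [sub_add_cancel] at w_zero
  rw [show n + 1 + 1 = n + 2 by ring] at w_two
  have h := hspec n
  simp only [hgauge, w_zero] at h
  push_cast
  rw [w_one, w_two]
  have hv_zero := hvc n
  have hv_one := hvc (n+1)
  have hv_two := hvc (n+2)
  have hρ_pred := hρc (n-1)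
  have hρ_zero := hρc n
  have hρ_one := hρc (n+1)
  field_simp at h ⊢
  linear_combination h
end

section
/- Let u, v, w : ℤ → ℝ, write f⁺(n) = f(n+1), and set d = v + u w⁺ + w⁺w⁺⁺; assume d(n) ≠ 0 for all n. Define u^⊕ = u⁺ + w⁺⁺⁺ − (d⁺/d)w⁺, v^⊕ = (d⁺/d)v, w^⊕ = (d⁺/d)w⁺. Then for every ψ : ℤ → ℂ and every n ∈ ℤ: ψ(n+3) + u(n+1)ψ(n+2) + v(n+1)ψ(n+1) − w^⊕(n)[ψ(n+2) + u(n)ψ(n+1) + v(n)ψ(n)] = [ψ(n+3) − w(n+3)ψ(n+2)] + u^⊕(n)[ψ(n+2) − w(n+2)ψ(n+1)] + v^⊕(n)[ψ(n+1) − w(n+1)ψ(n)]. Equivalently, the operator identity (1 − w^⊕Λ⁻¹)Λ(Λ² + uΛ + v) = (Λ² + u^⊕Λ + v^⊕)(Λ − w⁺) holds, so that Λ(Λ² + uΛ + v)(Λ − w⁺)⁻¹ = (1 − w^⊕Λ⁻¹)⁻¹(Λ² + u^⊕Λ + v^⊕); this is the discrete symmetry of the RR2T of type (2,1). -/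
/-- d = v + u w⁺ + w⁺ w⁺⁺. -/
noncomputable def dOf (u v w : ℤ → ℝ) : ℤ → ℝ :=
  fun n => v n + u n * w (n+1) + w (n+1) * w (n+2)

/-- u^⊕ = u⁺ + w⁺⁺⁺ − (d⁺/d) w⁺. -/
noncomputable def uPlus (u v w : ℤ → ℝ) : ℤ → ℝ :=
  fun n => u (n+1) + w (n+3) - (dOf u v w (n+1) / dOf u v w n) * w (n+1)

/-- v^⊕ = (d⁺/d) v. -/
noncomputable def vPlus (u v w : ℤ → ℝ) : ℤ → ℝ :=
  fun n => (dOf u v w (n+1) / dOf u v w n) * v n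

/-- w^⊕ = (d⁺/d) w⁺. -/
noncomputable def wPlus (u v w : ℤ → ℝ) : ℤ → ℝ :=
  fun n => (dOf u v w (n+1) / dOf u v w n) * w (n+1)

/-- the discrete symmetry of the RR2T of type (2,1):
(1 − w^⊕Λ⁻¹)Λ(Λ² + uΛ + v) = (Λ² + u^⊕Λ + v^⊕)(Λ − w⁺) as operators, stated pointwise
on arbitrary wave functions ψ. -/
theorem discrete_symmetry_RR2T (u v w : ℤ → ℝ)
    (hd : ∀ n, dOf u v w n ≠ 0) :
    ∀ (ψ : ℤ → ℂ) (n : ℤ),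
      ψ (n+3) + (u (n+1) : ℂ) * ψ (n+2) + (v (n+1) : ℂ) * ψ (n+1)
        - (wPlus u v w n : ℂ) * (ψ (n+2) + (u n : ℂ) * ψ (n+1) + (v n : ℂ) * ψ n)
      = (ψ (n+3) - (w (n+3) : ℂ) * ψ (n+2))
        + (uPlus u v w n : ℂ) * (ψ (n+2) - (w (n+2) : ℂ) * ψ (n+1))
        + (vPlus u v w n : ℂ) * (ψ (n+1) - (w (n+1) : ℂ) * ψ n) := by
  intro ψ n
  have hk : dOf u v w (n+1) / dOf u v w n * (v n + u n * w (n+1) + w (n+1) * w (n+2))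
      = v (n+1) + u (n+1) * w (n+2) + w (n+2) * w (n+3) := by
    have h : dOf u v w (n+1) / dOf u v w n * dOf u v w n = dOf u v w (n+1) :=
      div_mul_cancel₀ _ (hd n)
    have h2 : n + 1 + 1 = n + 2 := by ring
    have h3 : n + 1 + 2 = n + 3 := by ring
    calc _ = dOf u v w (n+1) := h
      _ = _ := by simp only [dOf, h2, h3]
  simp only [uPlus, vPlus, wPlus]
  generalize dOf u v w (n+1) / dOf u v w n = k at hk ⊢
  have hc := congrArg (fun x : ℝ => (x : ℂ)) hk
  push_cast at hc ⊢
  linear_combination (-ψ (n+1)) * hc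
end

section
/- Let u, v, w : ℤ → ℝ, write f⁺(n) = f(n+1), f⁻(n) = f(n−1), set d = v + u w⁺ + w⁺w⁺⁺ and g = v + u⁻w + w w⁻, and assume d(n) ≠ 0 and g(n) ≠ 0 for all n. Define u^⊕ = u⁺ + w⁺⁺⁺ − (d⁺/d)w⁺, v^⊕ = (d⁺/d)v, w^⊕ = (d⁺/d)w⁺ and u^⊖ = u⁻ + w⁻ − (g/g⁺)w⁺, v^⊖ = (g⁻/g)v, w^⊖ = (g⁻⁻/g⁻)w⁻. Then the maps (u,v,w) ↦ (u^⊕,v^⊕,w^⊕) and (u,v,w) ↦ (u^⊖,v^⊖,w^⊖) are mutually inverse: applying ⊕ and then ⊖ (to the resulting triple, with its own d- and g-quantities, which are automatically nonvanishing) returns (u,v,w), and likewise applying ⊖ and then ⊕ returns (u,v,w). -/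
/-- g = v + u⁻ w + w w⁻. -/
noncomputable def gOf (u v w : ℤ → ℝ) : ℤ → ℝ :=
  fun n => v n + u (n-1) * w n + w n * w (n-1)

/-- u^⊖ = u⁻ + w⁻ − (g/g⁺) w⁺. -/
noncomputable def uMinus (u v w : ℤ → ℝ) : ℤ → ℝ :=
  fun n => u (n-1) + w (n-1) - (gOf u v w n / gOf u v w (n+1)) * w (n+1)

/-- v^⊖ = (g⁻/g) v. -/
noncomputable def vMinus (u v w : ℤ → ℝ) : ℤ → ℝ :=
  fun n => (gOf u v w (n-1) / gOf u v w n) * v n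

/-- w^⊖ = (g⁻⁻/g⁻) w⁻. -/
noncomputable def wMinus (u v w : ℤ → ℝ) : ℤ → ℝ :=
  fun n => (gOf u v w (n-2) / gOf u v w (n-1)) * w (n-1)

/-- The `g`-quantity of the image under `⊕` is the shifted `d`-quantity. -/
theorem gOf_plus (u v w : ℤ → ℝ) (hd : ∀ n, dOf u v w n ≠ 0) (n : ℤ) :
    gOf (uPlus u v w) (vPlus u v w) (wPlus u v w) n = dOf u v w (n + 1) := by
  have h : dOf u v w (n + 1) / dOf u v w n * dOf u v w n = dOf u v w (n + 1) :=
    div_mul_cancel₀ _ (hd n)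
  have e : dOf u v w n = v n + u n * w (n + 1) + w (n + 1) * w (n + 2) := rfl
  simp only [gOf, uPlus, vPlus, wPlus, sub_add_cancel, show n - 1 + 3 = n + 2 by ring]
  linear_combination h - dOf u v w (n + 1) / dOf u v w n * e

/-- The `d`-quantity of the image under `⊖` is the shifted `g`-quantity. -/
theorem dOf_minus (u v w : ℤ → ℝ) (hg : ∀ n, gOf u v w n ≠ 0) (n : ℤ) :
    dOf (uMinus u v w) (vMinus u v w) (wMinus u v w) n = gOf u v w (n - 1) := by
  have h : gOf u v w (n - 1) / gOf u v w n * gOf u v w n = gOf u v w (n - 1) :=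
    div_mul_cancel₀ _ (hg n)
  have e : gOf u v w n = v n + u (n - 1) * w n + w n * w (n - 1) := rfl
  simp only [dOf, uMinus, vMinus, wMinus, add_sub_cancel_right, show n + 1 - 2 = n - 1 by ring,
    show n + 2 - 2 = n by ring, show n + 2 - 1 = n + 1 by ring]
  linear_combination h - gOf u v w (n - 1) / gOf u v w n * e

/-- the maps (u,v,w) ↦ (u^⊕,v^⊕,w^⊕) and (u,v,w) ↦ (u^⊖,v^⊖,w^⊖) are
mutually inverse; the relevant d- and g-quantities of the images are automatically
nonvanishing. -/
theorem discrete_symmetry_inverse (u v w : ℤ → ℝ)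
    (hd : ∀ n, dOf u v w n ≠ 0) (hg : ∀ n, gOf u v w n ≠ 0) :
    ((∀ n, gOf (uPlus u v w) (vPlus u v w) (wPlus u v w) n ≠ 0)
      ∧ uMinus (uPlus u v w) (vPlus u v w) (wPlus u v w) = u
      ∧ vMinus (uPlus u v w) (vPlus u v w) (wPlus u v w) = v
      ∧ wMinus (uPlus u v w) (vPlus u v w) (wPlus u v w) = w)
    ∧ ((∀ n, dOf (uMinus u v w) (vMinus u v w) (wMinus u v w) n ≠ 0)
      ∧ uPlus (uMinus u v w) (vMinus u v w) (wMinus u v w) = u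
      ∧ vPlus (uMinus u v w) (vMinus u v w) (wMinus u v w) = v
      ∧ wPlus (uMinus u v w) (vMinus u v w) (wMinus u v w) = w) := by
  refine ⟨⟨fun n => ?_, ?_, ?_, ?_⟩, fun n => ?_, ?_, ?_, ?_⟩
  · rw [gOf_plus u v w hd]
    exact hd _
  · funext n
    have h₁ := hd (n + 1)
    have h₂ := hd (n + 2)
    simp only [uMinus, gOf_plus u v w hd]
    simp only [uPlus, wPlus, sub_add_cancel, show n - 1 + 3 = n + 2 by ring,
      show n + 1 + 1 = n + 2 by ring]
    field_simp
    ring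
  · funext n
    have h₀ := hd n
    have h₁ := hd (n + 1)
    simp only [vMinus, gOf_plus u v w hd]
    simp only [vPlus, sub_add_cancel]
    field_simp
  · funext n
    have h₀ := hd n
    have h₁ := hd (n - 1)
    simp only [wMinus, gOf_plus u v w hd]
    simp only [wPlus, sub_add_cancel, show n - 2 + 1 = n - 1 by ring]
    field_simp
  · rw [dOf_minus u v w hg]
    exact hg _
  · funext n
    have h₀ := hg n
    have h₁ := hg (n - 1)
    simp only [uPlus, dOf_minus u v w hg]
    simp only [uMinus, wMinus, add_sub_cancel_right, show n + 1 + 1 = n + 2 by ring,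
      show n + 3 - 2 = n + 1 by ring, show n + 3 - 1 = n + 2 by ring,
      show n + 1 - 2 = n - 1 by ring]
    field_simp
    ring
  · funext n
    have h₀ := hg n
    have h₁ := hg (n - 1)
    simp only [vPlus, dOf_minus u v w hg]
    simp only [vMinus, add_sub_cancel_right]
    field_simp
  · funext n
    have h₀ := hg n
    have h₁ := hg (n - 1)
    simp only [wPlus, dOf_minus u v w hg]
    simp only [wMinus, add_sub_cancel_right, show n + 1 - 2 = n - 1 by ring]
    field_simp
end

section
/- Let u, v, w : ℤ×ℤ → ℝ; for functions on ℤ×ℤ write f⁺(n,m) = f(n+1,m), f⁻(n,m) = f(n−1,m) (shifts in the first variable), set d = v + u w⁺ + w⁺w⁺⁺, and assume d(n,m) ≠ 0 for all (n,m). Suppose that for all (n,m): u(n,m+1) = u⁺ + w⁺⁺⁺ − (d⁺/d)w⁺, v(n,m+1) = (d⁺/d)v, w(n,m+1) = (d⁺/d)w⁺ (right-hand sides evaluated at (n,m)). Let λ ∈ ℂ and let ψ : ℤ×ℤ → ℂ satisfy, for all (n,m): (i) ψ(n,m+1) = ψ(n+1,m) − w(n+1,m)ψ(n,m); (ii) ψ(n+2,m)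 + u(n,m)ψ(n+1,m) + v(n,m)ψ(n,m) = λ(ψ(n,m) − w(n,m)ψ(n−1,m)). Then for all (n,m): ψ(n,m+2) + û ψ(n,m+1) + v̂ ψ(n,m) + ŵ ψ(n,m−1) = λ ψ(n,m), where û = w(n+1,m+1) + u + w + w⁺⁺, v̂ = v + u⁻w + u w⁺ + w⁻w + w w⁺ + w⁺w⁺⁺, ŵ = v⁻w + u⁻⁻w⁻w + w⁻⁻w⁻w, all unshifted quantities evaluated at (n,m). -/
/-- d(n,m) = v + u w⁺ + w⁺ w⁺⁺, shifts acting in the first (discrete space) variable. -/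
noncomputable def dOf2 (u v w : ℤ → ℤ → ℝ) : ℤ → ℤ → ℝ :=
  fun n m => v n m + u n m * w (n+1) m + w (n+1) m * w (n+2) m

/-- combining the discrete evolution Λ̂ψ = (Λ − w⁺)ψ with the spectral
problem Lψ = λψ of the (2,1)-type RR2T yields the spectral problem
(Λ̂² + ûΛ̂ + v̂ + ŵΛ̂⁻¹)ψ = λψ of the three-component bi-graded Toda hierarchy. -/
theorem reciprocal_to_bigraded_Toda
    (u v w : ℤ → ℤ → ℝ) (ψ : ℤ → ℤ → ℂ) (lam : ℂ)
    (hd : ∀ n m, dOf2 u v w n m ≠ 0)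
    (hu : ∀ n m, u n (m+1)
        = u (n+1) m + w (n+3) m - (dOf2 u v w (n+1) m / dOf2 u v w n m) * w (n+1) m)
    (hv : ∀ n m, v n (m+1) = (dOf2 u v w (n+1) m / dOf2 u v w n m) * v n m)
    (hw : ∀ n m, w n (m+1) = (dOf2 u v w (n+1) m / dOf2 u v w n m) * w (n+1) m)
    (hψ1 : ∀ n m, ψ n (m+1) = ψ (n+1) m - (w (n+1) m : ℂ) * ψ n m)
    (hψ2 : ∀ n m, ψ (n+2) m + (u n m : ℂ) * ψ (n+1) m + (v n m : ℂ) * ψ n m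
        = lam * (ψ n m - (w n m : ℂ) * ψ (n-1) m)) :
    ∀ n m, ψ n (m+2)
        + ((w (n+1) (m+1) + u n m + w n m + w (n+2) m : ℝ) : ℂ) * ψ n (m+1)
        + ((v n m + u (n-1) m * w n m + u n m * w (n+1) m + w (n-1) m * w n m
            + w n m * w (n+1) m + w (n+1) m * w (n+2) m : ℝ) : ℂ) * ψ n m
        + ((v (n-1) m * w n m + u (n-2) m * w (n-1) m * w n m
            + w (n-2) m * w (n-1) m * w n m : ℝ) : ℂ) * ψ n (m-1)
      = lam * ψ n m := by
  intro n m
  obtain ⟨r, hw₁, hv₁⟩ : ∃ r : ℝ, w (n-1) m = r * w n (m-1) ∧ v (n-1) m = r * v (n-1) (m-1) := by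
    have h₁ := hw (n-1) (m-1)
    have h₂ := hv (n-1) (m-1)
    simp only [sub_add_cancel] at h₁ h₂
    exact ⟨_, h₁, h₂⟩
  have huw : u (n-2) m + w (n-2) m = u (n-1) (m-1) + w (n+1) (m-1) := by
    have h₁ := hu (n-2) (m-1)
    have h₂ := hw (n-2) (m-1)
    rw [sub_add_cancel, show n - 2 + 1 = n - 1 by ring] at h₁ h₂
    rw [show n - 2 + 3 = n + 1 by ring] at h₁
    linarith
  have hψ_up := hψ1 n (m+1)
  rw [show m + 1 + 1 = m + 2 by ring] at hψ_up
  have hψ_up₀ := hψ1 n m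
  have hψ_up₁ := hψ1 (n+1) m
  rw [show n + 1 + 1 = n + 2 by ring] at hψ_up₁
  have hψ_down₀ := hψ1 n (m-1)
  have hψ_down₁ := hψ1 (n-1) (m-1)
  have hψ_down₂ := hψ1 (n-2) (m-1)
  simp only [sub_add_cancel] at hψ_down₀ hψ_down₁ hψ_down₂
  rw [show n - 2 + 1 = n - 1 by ring] at hψ_down₂
  have hspec₀ := hψ2 n m
  have hspec₁ := hψ2 (n-1) m
  have hspec_down := hψ2 (n-1) (m-1)
  rw [show n - 1 + 2 = n + 1 by ring, sub_add_cancel, show n - 1 - 1 = n - 2 by ring]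
    at hspec₁ hspec_down
  have hw₁' : (w (n-1) m : ℂ) = r * w n (m-1) := mod_cast hw₁
  have hv₁' : (v (n-1) m : ℂ) = r * v (n-1) (m-1) := mod_cast hv₁
  have huw' : (u (n-2) m + w (n-2) m : ℂ) = u (n-1) (m-1) + w (n+1) (m-1) := mod_cast huw
  have hclosing : ((v (n-1) m : ℂ) + u (n-2) m * w (n-1) m + w (n-2) m * w (n-1) m) * ψ n (m-1)
      = v (n-1) m * ψ (n-1) m - w (n-1) m * ψ n m + lam * w (n-1) m * ψ (n-2) m := by
    rw [hψ_down₀, hψ_down₁, hψ_down₂]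
    linear_combination (w (n-1) m : ℂ) * ψ n (m-1) * huw' + (w (n-1) m : ℂ) * hspec_down
      - (v (n-1) (m-1) : ℂ) * ψ (n-1) (m-1) * hw₁' + (w n (m-1) : ℂ) * ψ (n-1) (m-1) * hv₁'
  push_cast
  rw [hψ_up, hψ_up₁, hψ_up₀]
  linear_combination hspec₀ + (w n m : ℂ) * hspec₁ + (w n m : ℂ) * hclosing
end

section
/- Let ε > 0, λ ∈ ℂ, and let u, v, w, b : ℤ×ℝ → ℝ and ψ : ℤ×ℝ → ℂ be infinitely differentiable in the second variable t. Write f⁺(n,t) = f(n+1,t), f⁻(n,t) = f(n−1,t) and f_t = ∂f/∂t. Assume, for all (n,t): (i) b + b⁺ = u + w; (ii) ψ⁺ = (ε/√2)ψ_t − bψ; (iii) ψ⁺⁺ + uψ⁺ + vψ = λ(ψ − wψ⁻). Define z̃¹ = √2 w⁺( w⁺(b + b⁺) + b² − (b⁺)² + v⁺ ) + ε( 2b⁺b⁺_t − 2b b_t − (b + b⁺)w⁺_t − 2w⁺(b_t + b⁺_t) − v⁺_t ) + (ε²/√2)(b_{tt} + b⁺_{tt}), z̃² = w⁺(b + b⁺)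 − (b⁺)² + v⁺ − (ε/√2)(b⁺_t + 2b_t), z̃³ = √2(b + w⁺). Then for all (n,t): (ε³/2)ψ_{ttt} − (ε²/2) z̃³ ψ_{tt} + ε z̃² ψ_t + ( z̃¹ − z̃² z̃³ + ε z̃²_t )ψ = λ( ε ψ_t − z̃³ ψ ). -/
/-- Derivative in the continuous (second) variable, for real-valued functions. -/
noncomputable def dt (f : ℤ → ℝ → ℝ) : ℤ → ℝ → ℝ := fun n t => deriv (f n) t

/-- Derivative in the continuous (second) variable, for complex-valued functions. -/
noncomputable def dtC (f : ℤ → ℝ → ℂ) : ℤ → ℝ → ℂ := fun n t => deriv (f n) t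

/-- z̃¹ in terms of b, v, w and ε. -/
noncomputable def z1t (b v w : ℤ → ℝ → ℝ) (ε : ℝ) : ℤ → ℝ → ℝ := fun n t =>
  Real.sqrt 2 * w (n+1) t *
      (w (n+1) t * (b n t + b (n+1) t) + (b n t)^2 - (b (n+1) t)^2 + v (n+1) t)
    + ε * (2 * b (n+1) t * dt b (n+1) t - 2 * b n t * dt b n t
        - (b n t + b (n+1) t) * dt w (n+1) t
        - 2 * w (n+1) t * (dt b n t + dt b (n+1) t)
        - dt v (n+1) t)
    + (ε^2 / Real.sqrt 2) * (dt (dt b) n t + dt (dt b) (n+1) t)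

/-- z̃² in terms of b, v, w and ε. -/
noncomputable def z2t (b v w : ℤ → ℝ → ℝ) (ε : ℝ) : ℤ → ℝ → ℝ := fun n t =>
  w (n+1) t * (b n t + b (n+1) t) - (b (n+1) t)^2 + v (n+1) t
    - (ε / Real.sqrt 2) * (dt b (n+1) t + 2 * dt b n t)

/-- z̃³ in terms of b and w. -/
noncomputable def z3t (b w : ℤ → ℝ → ℝ) : ℤ → ℝ → ℝ := fun n t =>
  Real.sqrt 2 * (b n t + w (n+1) t)

theorem hasDerivAt_dt {f : ℤ → ℝ → ℝ} (hf : ∀ n, ContDiff ℝ (⊤ : ℕ∞) (f n)) (n : ℤ) (t : ℝ) :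
    HasDerivAt (f n) (dt f n t) t :=
  ((hf n).differentiable (by simp) t).hasDerivAt

theorem hasDerivAt_dtC {f : ℤ → ℝ → ℂ} (hf : ∀ n, ContDiff ℝ (⊤ : ℕ∞) (f n)) (n : ℤ) (t : ℝ) :
    HasDerivAt (f n) (dtC f n t) t :=
  ((hf n).differentiable (by simp) t).hasDerivAt

theorem contDiff_dt {f : ℤ → ℝ → ℝ} (hf : ∀ n, ContDiff ℝ (⊤ : ℕ∞) (f n)) (n : ℤ) :
    ContDiff ℝ (⊤ : ℕ∞) (dt f n) :=
  (contDiff_infty_iff_deriv.mp (hf n)).2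

theorem contDiff_dtC {f : ℤ → ℝ → ℂ} (hf : ∀ n, ContDiff ℝ (⊤ : ℕ∞) (f n)) (n : ℤ) :
    ContDiff ℝ (⊤ : ℕ∞) (dtC f n) :=
  (contDiff_infty_iff_deriv.mp (hf n)).2

theorem dt_z2t {b v w : ℤ → ℝ → ℝ} (ε : ℝ) (hv : ∀ n, ContDiff ℝ (⊤ : ℕ∞) (v n))
    (hw : ∀ n, ContDiff ℝ (⊤ : ℕ∞) (w n)) (hb : ∀ n, ContDiff ℝ (⊤ : ℕ∞) (b n))
    (n : ℤ) (t : ℝ) :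
    dt (z2t b v w ε) n t =
      dt w (n+1) t * (b n t + b (n+1) t) + w (n+1) t * (dt b n t + dt b (n+1) t)
        - 2 * b (n+1) t * dt b (n+1) t + dt v (n+1) t
        - (ε / Real.sqrt 2) * (dt (dt b) (n+1) t + 2 * dt (dt b) n t) := by
  have hb' := contDiff_dt hb
  have h := ((((hasDerivAt_dt hw (n+1) t).mul
    ((hasDerivAt_dt hb n t).add (hasDerivAt_dt hb (n+1) t))).sub
    ((hasDerivAt_dt hb (n+1) t).pow 2)).add (hasDerivAt_dt hv (n+1) t)).sub
    (((hasDerivAt_dt hb' (n+1) t).add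
      ((hasDerivAt_dt hb' n t).const_mul 2)).const_mul (ε / Real.sqrt 2))
  refine h.deriv.trans ?_
  simp only [Pi.add_apply]
  ring

/-- Differentiating the evolution `ψ⁺ = c ψ_t - b ψ`. -/
theorem dtC_shift {b : ℤ → ℝ → ℝ} {φ χ : ℤ → ℝ → ℂ} {c : ℂ} {n m : ℤ}
    (hb : ∀ n, ContDiff ℝ (⊤ : ℕ∞) (b n)) (hφ : ∀ n, ContDiff ℝ (⊤ : ℕ∞) (φ n))
    (h : ∀ t, χ m t = c * dtC φ n t - (b n t : ℂ) * φ n t) (t : ℝ) :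
    dtC χ m t = c * dtC (dtC φ) n t
      - ((dt b n t : ℂ) * φ n t + (b n t : ℂ) * dtC φ n t) := by
  have hd := ((hasDerivAt_dtC (contDiff_dtC hφ) n t).const_mul c).sub
    ((hasDerivAt_dt hb n t).ofReal_comp.mul (hasDerivAt_dtC hφ n t))
  have he : χ m = _ := funext h
  rw [dtC, he]
  exact hd.deriv

/-- Differentiating the evolution `ψ⁺ = c ψ_t - b ψ` twice. -/
theorem dtC_dtC_shift {b : ℤ → ℝ → ℝ} {φ χ : ℤ → ℝ → ℂ} {c : ℂ} {n m : ℤ}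
    (hb : ∀ n, ContDiff ℝ (⊤ : ℕ∞) (b n)) (hφ : ∀ n, ContDiff ℝ (⊤ : ℕ∞) (φ n))
    (h : ∀ t, χ m t = c * dtC φ n t - (b n t : ℂ) * φ n t) (t : ℝ) :
    dtC (dtC χ) m t = c * dtC (dtC (dtC φ)) n t
      - (((dt (dt b) n t : ℂ) * φ n t + (dt b n t : ℂ) * dtC φ n t)
        + ((dt b n t : ℂ) * dtC φ n t + (b n t : ℂ) * dtC (dtC φ) n t)) := by
  have hφ' := contDiff_dtC hφ
  have hd := ((hasDerivAt_dtC (contDiff_dtC hφ') n t).const_mul c).sub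
    (((hasDerivAt_dt (contDiff_dt hb) n t).ofReal_comp.mul (hasDerivAt_dtC hφ n t)).add
      ((hasDerivAt_dt hb n t).ofReal_comp.mul (hasDerivAt_dtC hφ' n t)))
  have he : dtC χ m = _ := funext (dtC_shift hb hφ h)
  rw [dtC, he]
  exact hd.deriv

/-- the (2,1)-type RR2T is related to the constrained KP hierarchy by a
linear reciprocal transformation: the wave function satisfies the cross-multiplied
spectral problem of the constrained KP hierarchy. -/
theorem reciprocal_to_constrained_KP (ε : ℝ) (hε : 0 < ε) (lam : ℂ)
    (u v w b : ℤ → ℝ → ℝ) (ψ : ℤ → ℝ → ℂ)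
    (hu : ∀ n, ContDiff ℝ (⊤ : ℕ∞) (u n)) (hv : ∀ n, ContDiff ℝ (⊤ : ℕ∞) (v n))
    (hw : ∀ n, ContDiff ℝ (⊤ : ℕ∞) (w n)) (hb : ∀ n, ContDiff ℝ (⊤ : ℕ∞) (b n))
    (hψ : ∀ n, ContDiff ℝ (⊤ : ℕ∞) (ψ n))
    (h1 : ∀ n t, b n t + b (n+1) t = u n t + w n t)
    (h2 : ∀ n t, ψ (n+1) t = ((ε / Real.sqrt 2 : ℝ) : ℂ) * dtC ψ n t - (b n t : ℂ) * ψ n t)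
    (h3 : ∀ n t, ψ (n+2) t + (u n t : ℂ) * ψ (n+1) t + (v n t : ℂ) * ψ n t
        = lam * (ψ n t - (w n t : ℂ) * ψ (n-1) t)) :
    ∀ n t, ((ε^3/2 : ℝ) : ℂ) * dtC (dtC (dtC ψ)) n t
        - ((ε^2/2 * z3t b w n t : ℝ) : ℂ) * dtC (dtC ψ) n t
        + ((ε * z2t b v w ε n t : ℝ) : ℂ) * dtC ψ n t
        + ((z1t b v w ε n t - z2t b v w ε n t * z3t b w n t
            + ε * dt (z2t b v w ε) n t : ℝ) : ℂ) * ψ n t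
      = lam * (((ε : ℝ) : ℂ) * dtC ψ n t - ((z3t b w n t : ℝ) : ℂ) * ψ n t) := by
  intro n t
  have e2 : n + 1 + 1 = n + 2 := by ring
  have e3 : n + 1 + 2 = n + 2 + 1 := by ring
  have k0 := h2 n t
  have k1 := h2 (n+1) t
  have k2 := h2 (n+2) t
  have d0 := dtC_shift hb hψ (h2 n) t
  have d1 := dtC_shift hb hψ (h2 (n+1)) t
  have dd0 := dtC_dtC_shift hb hψ (h2 n) t
  have k := h3 (n+1) t
  have hu1 : u (n+1) t = b (n+1) t + b (n+2) t - w (n+1) t := by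
    have := h1 (n+1) t
    rw [e2] at this
    linarith
  rw [e2] at k1 d1
  rw [e3, add_sub_cancel_right, e2, hu1, k2, d1, k1, dd0, d0, k0] at k
  rw [dt_z2t ε hv hw hb]
  have hs : (Real.sqrt 2) ^ 2 = 2 := Real.sq_sqrt (by norm_num)
  have hdiv : ε / Real.sqrt 2 = ε * Real.sqrt 2 / 2 := by
    rw [div_eq_div_iff (by positivity) two_ne_zero]
    linear_combination -ε * hs
  have hdiv2 : ε ^ 2 / Real.sqrt 2 = ε ^ 2 * Real.sqrt 2 / 2 := by
    rw [div_eq_div_iff (by positivity) two_ne_zero]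
    linear_combination -ε ^ 2 * hs
  have hsC : ((Real.sqrt 2 : ℝ) : ℂ) ^ 2 = 2 := by exact_mod_cast hs
  simp only [z1t, z2t, z3t, hdiv, hdiv2] at k ⊢
  push_cast at k ⊢
  generalize ((Real.sqrt 2 : ℝ) : ℂ) = s at *
  have hs4 : s ^ 4 = 4 := by linear_combination (s ^ 2 + 2) * hsC
  have hs3 : s ^ 3 = 2 * s := by linear_combination s * hsC
  replace k := congrArg (fun z => s * z) k
  ring_nf at k ⊢
  simp only [hsC, hs3, hs4] at k ⊢
  linear_combination k
end

section
/- The potential F̂(ẑ¹,ẑ²,ẑ³) = ½(ẑ¹)²ẑ³ + ½ẑ¹(ẑ²)² − (1/24)(ẑ²)⁴ + √2 ẑ² e^{ẑ³} of the Frobenius manifold of the three-component extended bi-graded Toda hierarchy satisfies, on all of ℝ³: (i) the WDVV associativity equations Σ_{μ,ν} (∂³F̂/∂ẑ^α∂ẑ^β∂ẑ^μ) η^{μν} (∂³F̂/∂ẑ^ν∂ẑ^γ∂ẑ^δ) = Σ_{μ,ν} (∂³F̂/∂ẑ^δ∂ẑ^β∂ẑ^μ) η^{μν} (∂³F̂/∂ẑ^ν∂ẑ^γ∂ẑ^α)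 for all α,β,γ,δ ∈ {1,2,3}; (ii) the quasi-homogeneity condition Ê F̂ = 2F̂ + (3/4)(ẑ¹)², where Ê = ẑ¹∂/∂ẑ¹ + ½ẑ²∂/∂ẑ² + (3/2)∂/∂ẑ³. -/
/-- The potential F̂ of the Frobenius manifold of the three-component extended
bi-graded Toda hierarchy. -/
noncomputable def Fhat (a b c : ℝ) : ℝ :=
  (1/2)*a^2*c + (1/2)*a*b^2 - (1/24)*b^4 + Real.sqrt 2 * b * Real.exp c

/-- Third partial derivatives of F̂. -/
noncomputable def cFhat (a b g : Fin 3) : ℝ → ℝ → ℝ → ℝ := pd a (pd b (pd g Fhat))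

/-- The gradient of F̂. -/
noncomputable def gradFhat (i : Fin 3) (a b c : ℝ) : ℝ :=
  ![a * c + b ^ 2 / 2, a * b - b ^ 3 / 6 + √2 * Real.exp c, a ^ 2 / 2 + √2 * b * Real.exp c] i

/-- The Hessian matrix of F̂. -/
noncomputable def hessFhat (i j : Fin 3) (a b c : ℝ) : ℝ :=
  ![![c, b, a], ![b, a - b ^ 2 / 2, √2 * Real.exp c],
    ![a, √2 * Real.exp c, √2 * b * Real.exp c]] i j

/-- The tensor of third derivatives of F̂. -/
noncomputable def thirdFhat (i j k : Fin 3) (b c : ℝ) : ℝ :=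
  ![![![0, 0, 1], ![0, 1, 0], ![1, 0, 0]],
    ![![0, 1, 0], ![1, -b, 0], ![0, 0, √2 * Real.exp c]],
    ![![1, 0, 0], ![0, 0, √2 * Real.exp c], ![0, √2 * Real.exp c, √2 * b * Real.exp c]]] i j k

theorem pd_eq_of_hasDerivAt {f f₁ f₂ f₃ : ℝ → ℝ → ℝ → ℝ}
    (h₁ : ∀ x y z, HasDerivAt (fun t => f t y z) (f₁ x y z) x)
    (h₂ : ∀ x y z, HasDerivAt (fun t => f x t z) (f₂ x y z) y)
    (h₃ : ∀ x y z, HasDerivAt (fun t => f x y t) (f₃ x y z) z) (i : Fin 3) :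
    pd i f = ![f₁, f₂, f₃] i := by
  funext x y z
  fin_cases i
  · exact (h₁ x y z).deriv
  · exact (h₂ x y z).deriv
  · exact (h₃ x y z).deriv

theorem pd_Fhat (i : Fin 3) : pd i Fhat = gradFhat i := by
  rw [pd_eq_of_hasDerivAt (f := Fhat) (f₁ := gradFhat 0) (f₂ := gradFhat 1) (f₃ := gradFhat 2)]
  · fin_cases i <;> rfl
  · intro x y z
    have h := hasDerivAt_id' x
    refine (((((h.pow 2).const_mul (1 / 2)).mul_const z).add
      ((h.const_mul (1 / 2)).mul_const (y ^ 2))).sub_const (1 / 24 * y ^ 4)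
      |>.add_const (√2 * y * Real.exp z)).congr_deriv ?_
    simp [gradFhat]
    ring
  · intro x y z
    have h := hasDerivAt_id' y
    refine ((((h.pow 2).const_mul (1 / 2 * x)).const_add (1 / 2 * x ^ 2 * z)).sub
      ((h.pow 4).const_mul (1 / 24))
      |>.add ((h.const_mul (√2)).mul_const (Real.exp z))).congr_deriv ?_
    simp [gradFhat]
    ring
  · intro x y z
    have h := hasDerivAt_id' z
    refine (((h.const_mul (1 / 2 * x ^ 2)).add_const (1 / 2 * x * y ^ 2)).sub_const
      (1 / 24 * y ^ 4) |>.add ((Real.hasDerivAt_exp z).const_mul (√2 * y))).congr_deriv ?_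
    simp [gradFhat]
    ring

theorem pd_gradFhat (i j : Fin 3) : pd i (gradFhat j) = hessFhat i j := by
  funext x y z
  have h : deriv (fun t => x * t - t ^ 3 / 6) y = x - y ^ 2 / 2 := by
    have hy := hasDerivAt_id' y
    refine ((hy.const_mul x).sub ((hy.pow 3).div_const 6)).deriv.trans ?_
    push_cast
    ring
  fin_cases i <;> fin_cases j <;> simp [pd, pd1, pd2, pd3, gradFhat, hessFhat, h]

theorem pd_hessFhat (i j k : Fin 3) (x y z : ℝ) :
    pd i (hessFhat j k) x y z = thirdFhat i j k y z := by
  fin_cases i <;> fin_cases j <;> fin_cases k <;>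
    simp [pd, pd1, pd2, pd3, hessFhat, thirdFhat]

theorem cFhat_eq (i j k : Fin 3) (x y z : ℝ) : cFhat i j k x y z = thirdFhat i j k y z := by
  rw [cFhat, pd_Fhat, pd_gradFhat, pd_hessFhat]

/-- F̂ satisfies the WDVV associativity equations on all of ℝ³ and the
quasi-homogeneity condition Ê F̂ = 2 F̂ + (3/4)(ẑ¹)² with
Ê = ẑ¹∂₁ + ½ẑ²∂₂ + (3/2)∂₃. -/
theorem Fhat_WDVV_and_quasihomogeneity :
    (∀ (x y z : ℝ) (α β γ δ : Fin 3),
      ∑ μ : Fin 3, ∑ ν : Fin 3, cFhat α β μ x y z * eta μ ν * cFhat ν γ δ x y z =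
      ∑ μ : Fin 3, ∑ ν : Fin 3, cFhat δ β μ x y z * eta μ ν * cFhat ν γ α x y z)
    ∧ (∀ x y z : ℝ,
      x * pd1 Fhat x y z + (1/2) * y * pd2 Fhat x y z + (3/2) * pd3 Fhat x y z
        = 2 * Fhat x y z + (3/4) * x^2) := by
  refine ⟨fun x y z α β γ δ => ?_, fun x y z => ?_⟩
  · simp only [cFhat_eq, Fin.sum_univ_three]
    fin_cases α <;> fin_cases β <;> fin_cases γ <;> fin_cases δ <;>
      simp [thirdFhat, eta] <;> ring
  · have h₁ : pd1 Fhat = gradFhat 0 := pd_Fhat 0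
    have h₂ : pd2 Fhat = gradFhat 1 := pd_Fhat 1
    have h₃ : pd3 Fhat = gradFhat 2 := pd_Fhat 2
    simp only [h₁, h₂, h₃, gradFhat, Fhat, Matrix.cons_val]
    ring
end
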